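/- Upper bound on stability: let (T, I, R) be a binary dataset with finite sets T and I, and let X and Y' be closed itemsets with X ⊊ Y'. Then Stab(X) ≤ 1 − 2^{−Δ(X,Y')}, where Δ(X,Y') = |t(X) \ t(Y')|. -/

import Mathlib

/-- `d(A) = ⋂_{t ∈ A} δ(t)`, with `d(∅) = I`. -/
def dOp {τ ι : Type*} [Fintype ι] (R : τ → ι → Prop) [∀ t i, Decidable (R t i)]
    (A : Finset τ) : Finset ι :=
  Finset.univ.filter (fun i => ∀ t ∈ A, R t i)

/-- `t(X) = {t ∈ T : X ⊆ δ(t)}`. -/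
def tOp {τ ι : Type*} [Fintype τ] (R : τ → ι → Prop) [∀ t i, Decidable (R t i)]
    (X : Finset ι) : Finset τ :=
  Finset.univ.filter (fun t => ∀ i ∈ X, R t i)

/-- Stability of `X` in `(T, I, R)`: `2^{-|T|}` times the number of subdatasets
`S ⊆ T` in which `X` is closed, i.e. `d(t(X) ∩ S) = X`. -/
noncomputable def stab {τ ι : Type*} [Fintype τ] [Fintype ι] [DecidableEq τ] [DecidableEq ι]
    (R : τ → ι → Prop) [∀ t i, Decidable (R t i)] (X : Finset ι) : ℝ :=
  ((Finset.univ.filter (fun S : Finset τ => dOp R (tOp R X ∩ S) = X)).card : ℝ) /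
    2 ^ (Fintype.card τ)

/-- Upper bound on stability: if `X` and `Y'` are closed itemsets with `X ⊊ Y'`,
then `Stab(X) ≤ 1 - 2^{-Δ(X,Y')}` where `Δ(X,Y') = |t(X) \ t(Y')|`. -/
theorem stab_upper_bound
    {τ ι : Type*} [Fintype τ] [Fintype ι] [DecidableEq τ] [DecidableEq ι]
    (R : τ → ι → Prop) [∀ t i, Decidable (R t i)]
    (X Y' : Finset ι)
    (hX : dOp R (tOp R X) = X) (hY' : dOp R (tOp R Y') = Y') (hss : X ⊂ Y') :
    stab R X ≤ 1 - (1 / 2 : ℝ) ^ ((tOp R X \ tOp R Y').card) := by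
  set D := tOp R X \ tOp R Y' with hD
  have hsub : Finset.univ.filter (fun S : Finset τ => dOp R (tOp R X ∩ S) = X) ⊆
      (Dᶜ.powerset)ᶜ := by
    intro S hS
    rw [Finset.mem_compl, Finset.mem_powerset]
    intro hSD
    have hS' : dOp R (tOp R X ∩ S) = X := (Finset.mem_filter.mp hS).2
    apply hss.2
    intro i hi
    rw [← hS']
    simp only [dOp, Finset.mem_filter_univ]
    intro t ht
    obtain ⟨h1, h2⟩ := Finset.mem_inter.mp ht
    have h3 := Finset.mem_compl.mp (hSD h2)
    have h4 : t ∈ tOp R Y' := by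
      by_contra h
      exact h3 (Finset.mem_sdiff.mpr ⟨h1, h⟩)
    simp only [tOp, Finset.mem_filter_univ] at h4
    exact h4 i hi
  have h1 := Finset.card_le_card hsub
  have h2 := Finset.card_add_card_compl (Dᶜ.powerset)
  have h3 := Finset.card_add_card_compl D
  rw [Finset.card_powerset, Fintype.card_finset] at h2
  unfold stab
  rw [div_le_iff₀ (by positivity)]
  have h1' : ((Finset.univ.filter (fun S : Finset τ => dOp R (tOp R X ∩ S) = X)).card : ℝ) ≤
      ((Dᶜ.powerset)ᶜ.card : ℝ) := by exact_mod_cast h1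
  have h2' : (2 : ℝ) ^ (Dᶜ).card + ((Dᶜ.powerset)ᶜ.card : ℝ) = 2 ^ Fintype.card τ := by
    exact_mod_cast h2
  have h4 : (1 / 2 : ℝ) ^ D.card * 2 ^ Fintype.card τ = 2 ^ (Dᶜ).card := by
    rw [← h3, pow_add, ← mul_assoc, ← mul_pow]
    norm_num
  rw [sub_mul, h4]
  linarith
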